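/- Let m₀ ≥ 1 and let u_{m₀} be a λ_{m₀}-eigenfunction of −Δ_{m₀}. For m ≥ m₀ define λ_{m+1} = φ₁(λ_m) and let u_{m+1} be the λ_{m+1}-extension of u_m. Then there exists a unique admissible continuous function u : ℝ/ℤ → ℝ with u(n/N_m) = u_m(n) for all m ≥ m₀ and all n ∈ ℤ/N_mℤ, and u is a λ-eigenfunction of −Δ on K, where λ = lim_{m→∞} 15^m λ_m. -/

import Mathlib

open scoped BigOperators

noncomputable section

namespace VNLE

/-- `N_m = 2·5^m`, the number of points on the circle at level `m`. -/
def Nm (m : ℕ) : ℕ := 2 * 5 ^ m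

/-- The partner of a vertex `n` of `K_m`: writing the representative `v` of `n`
(taking `v = 2·5^m` when `n = 0`) as `v = 5^k·a` with `5 ∤ a`, the partner is
`n + 5^k` if `a ≡ 1` or `3 (mod 5)`, and `n - 5^k` if `a ≡ 2` or `4 (mod 5)`.
This realizes the identifications `5^k(1+5j) ∼ 5^k(2+5j)` and
`5^k(3+5j) ∼ 5^k(4+5j)` in `ℤ/(2·5^m)ℤ`. -/
def partner (m : ℕ) (n : ZMod (Nm m)) : ZMod (Nm m) :=
  let v : ℕ := if n.val = 0 then Nm m else n.val
  let k : ℕ := padicValNat 5 v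
  if (v / 5 ^ k) % 5 = 1 ∨ (v / 5 ^ k) % 5 = 3 then n + ((5 ^ k : ℕ) : ZMod (Nm m))
  else n - ((5 ^ k : ℕ) : ZMod (Nm m))

/-- A function on `K_m`: a map on `ℤ/N_mℤ` constant on the identified pairs. -/
def IsKFun (m : ℕ) (u : ZMod (Nm m) → ℝ) : Prop := ∀ n, u (partner m n) = u n

/-- The graph Laplacian `−Δ_m`. -/
def lap (m : ℕ) (u : ZMod (Nm m) → ℝ) : ZMod (Nm m) → ℝ := fun n =>
  4 * u n - u (n + 1) - u (n - 1) - u (partner m n + 1) - u (partner m n - 1)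

/-- `u` is a `λ`-eigenfunction of `−Δ_m`. -/
def IsEigen (m : ℕ) (lam : ℝ) (u : ZMod (Nm m) → ℝ) : Prop :=
  IsKFun m u ∧ u ≠ 0 ∧ ∀ n, lap m u n = lam * u n

/-- The spectral decimation renormalization polynomial `R(x) = x(3−x)(5−x)`. -/
def R (x : ℝ) : ℝ := x * (3 - x) * (5 - x)

/-- The `λ'`-extension of a function on `K_m` to a function on `K_{m+1}`. -/
def extFun (m : ℕ) (lam' : ℝ) (u : ZMod (Nm m) → ℝ) : ZMod (Nm (m + 1)) → ℝ := fun x =>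
  let n : ZMod (Nm m) := ((x.val / 5 : ℕ) : ZMod (Nm m))
  if x.val % 5 = 0 then u n
  else if x.val % 5 = 1 ∨ x.val % 5 = 2 then
    ((2 - lam') * u n + u (n + 1)) / ((1 - lam') * (3 - lam'))
  else
    (u n + (2 - lam') * u (n + 1)) / ((1 - lam') * (3 - lam'))

/-- Restriction of a function on `K_{m+1}` to the old vertices, giving a function on `K_m`. -/
def down (m : ℕ) (v : ZMod (Nm (m + 1)) → ℝ) : ZMod (Nm m) → ℝ := fun n =>
  v (((5 * n.val : ℕ) : ZMod (Nm (m + 1))))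

/-- The Laplacian `−Δ_m` as a linear map. -/
def lapL (m : ℕ) : (ZMod (Nm m) → ℝ) →ₗ[ℝ] (ZMod (Nm m) → ℝ) where
  toFun := lap m
  map_add' u v := by funext n; simp only [lap, Pi.add_apply]; ring
  map_smul' c u := by funext n; simp only [lap, Pi.smul_apply, smul_eq_mul, RingHom.id_apply]; ring

/-- The subspace of functions on `K_m` (maps constant on identified pairs). -/
def KFunSub (m : ℕ) : Submodule ℝ (ZMod (Nm m) → ℝ) where
  carrier := {u | IsKFun m u}
  add_mem' := by
    intro u v hu hv n
    simp only [Pi.add_apply, hu n, hv n]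
  zero_mem' := fun _ => rfl
  smul_mem' := by
    intro c u hu n
    simp only [Pi.smul_apply, hu n]

/-- The `λ`-eigenspace of `−Δ_m` inside the space of functions on `K_m`. -/
def eigensp (m : ℕ) (lam : ℝ) : Submodule ℝ (ZMod (Nm m) → ℝ) :=
  LinearMap.ker (lapL m - lam • LinearMap.id) ⊓ KFunSub m

/-- `c = (8 − √19)/3`, the smaller critical point of `R`. -/
def cpt : ℝ := (8 - Real.sqrt 19) / 3

/-- `φ₁`, the inverse of the (strictly increasing) restriction of `R` to `[0, c]`. -/
def phi1 : ℝ → ℝ := Function.invFunOn R (Set.Icc 0 cpt)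

/-- Eigenvalue counting function: total dimension of the eigenspaces of `−Δ_m`
with eigenvalue `≤ t`. -/
def evCount (m : ℕ) (t : ℝ) : ℕ :=
  Module.finrank ℝ ↥(⨆ lam ∈ Set.Iic t, eigensp m lam)

/-- `evSorted m k = λ_k(m)`, the `k`-th smallest eigenvalue (with multiplicity,
`1 ≤ k ≤ 5^m`) of `−Δ_m` acting on functions on `K_m`. -/
def evSorted (m k : ℕ) : ℝ := sInf {t : ℝ | k ≤ evCount m t}

/-- The restriction of a function on the circle `ℝ/ℤ` to the level-`m` vertices. -/
def restr (u : AddCircle (1 : ℝ) → ℝ) (m : ℕ) : ZMod (Nm m) → ℝ := fun n =>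
  u (((n.val : ℝ) / (Nm m : ℝ) : ℝ) : AddCircle (1 : ℝ))

/-- A continuous function on the circle is admissible if at every level its values
agree on identified pairs, so that its restrictions are functions on `K_m`. -/
def Admissible (u : AddCircle (1 : ℝ) → ℝ) : Prop :=
  Continuous u ∧ ∀ m, 1 ≤ m → ∀ n : ZMod (Nm m), restr u m (partner m n) = restr u m n

/-- `u` is a `λ`-eigenfunction of `−Δ` on `K`: it is admissible, nonzero, and
`sup_n |15^m (−Δ_m u_m)(n) − λ u(n/N_m)| → 0` as `m → ∞`. -/
def IsEigenK (lam : ℝ) (u : AddCircle (1 : ℝ) → ℝ) : Prop :=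
  Admissible u ∧ u ≠ 0 ∧
    ∀ ε : ℝ, 0 < ε → ∃ M : ℕ, ∀ m, M ≤ m → ∀ n : ZMod (Nm m),
      |(15 : ℝ) ^ m * lap m (restr u m) n - lam * restr u m n| < ε

/-- The symmetry-type subspace `V_{ε₁,ε₂}` of functions on `K_m`. -/
def symSub (m : ℕ) (e1 e2 : ℝ) : Submodule ℝ (ZMod (Nm m) → ℝ) where
  carrier := {u | IsKFun m u ∧ (∀ n, u (-n) = e1 * u n) ∧
    (∀ n, u (((5 ^ m : ℕ) : ZMod (Nm m)) - n) = e2 * u n)}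
  add_mem' := by
    rintro u v ⟨hu, hu1, hu2⟩ ⟨hv, hv1, hv2⟩
    refine ⟨fun n => by simp only [Pi.add_apply, hu n, hv n],
      fun n => by simp only [Pi.add_apply, hu1 n, hv1 n]; ring,
      fun n => by simp only [Pi.add_apply, hu2 n, hv2 n]; ring⟩
  zero_mem' := ⟨fun _ => rfl, fun n => by simp, fun n => by simp⟩
  smul_mem' := by
    rintro c u ⟨hu, hu1, hu2⟩
    refine ⟨fun n => by simp only [Pi.smul_apply, hu n],
      fun n => by simp only [Pi.smul_apply, smul_eq_mul, hu1 n]; ring,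
      fun n => by simp only [Pi.smul_apply, smul_eq_mul, hu2 n]; ring⟩

lemma Nm_pos (m : ℕ) : 0 < Nm m := by unfold Nm; positivity

instance instNeZeroNm (m : ℕ) : NeZero (Nm m) := ⟨(Nm_pos m).ne'⟩

lemma Nm_succ (m : ℕ) : Nm (m + 1) = 5 * Nm m := by unfold Nm; ring

lemma five_mul_add_emod (z r N : ℤ) (hr0 : 0 ≤ r) (hr : r < 5) (hN : 0 < N) :
    (5 * z + r) % (5 * N) = 5 * (z % N) + r := by
  have h1 := Int.emod_nonneg z hN.ne'
  have h2 := Int.emod_lt_of_pos z hN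
  have h3 := Int.mul_ediv_add_emod z N
  have : 5 * z + r = (5 * (z % N) + r) + 5 * N * (z / N) := by linarith
  rw [this, Int.add_mul_emod_self_left, Int.emod_eq_of_lt (by omega) (by omega)]

lemma val_intCast_five_mul_add (m : ℕ) (z r : ℤ) (hr0 : 0 ≤ r) (hr : r < 5) :
    ((((5 * z + r : ℤ) : ZMod (Nm (m + 1))).val : ℕ) : ℤ)
      = 5 * (((z : ZMod (Nm m)).val : ℕ) : ℤ) + r := by
  rw [ZMod.val_intCast, ZMod.val_intCast, Nm_succ]
  push_cast
  exact five_mul_add_emod z r _ hr0 hr (by exact_mod_cast Nm_pos m)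

/-- An integer representing the partner of the class of `z`. -/
def partnerInt (m : ℕ) (z : ℤ) : ℤ :=
  let v : ℕ := if (z : ZMod (Nm m)).val = 0 then Nm m else (z : ZMod (Nm m)).val
  let k : ℕ := padicValNat 5 v
  if (v / 5 ^ k) % 5 = 1 ∨ (v / 5 ^ k) % 5 = 3 then z + 5 ^ k else z - 5 ^ k

lemma partner_intCast (m : ℕ) (z : ℤ) :
    partner m (z : ZMod (Nm m)) = ((partnerInt m z : ℤ) : ZMod (Nm m)) := by
  unfold partner partnerInt
  split_ifs <;> push_cast <;> rfl

lemma partnerInt_five_mul (m : ℕ) (z : ℤ) :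
    partnerInt (m + 1) (5 * z) = 5 * partnerInt m z := by
  have hval : ((5 * z : ℤ) : ZMod (Nm (m + 1))).val = 5 * (z : ZMod (Nm m)).val := by
    have := val_intCast_five_mul_add m z 0 le_rfl (by norm_num)
    rw [add_zero, add_zero] at this
    exact_mod_cast this
  unfold partnerInt
  rw [hval]
  set w : ℕ := if (z : ZMod (Nm m)).val = 0 then Nm m else (z : ZMod (Nm m)).val with hw
  have hw0 : w ≠ 0 := by
    rw [hw]; split_ifs with h
    · exact (Nm_pos m).ne'
    · exact h
  have hv : (if 5 * (z : ZMod (Nm m)).val = 0 then Nm (m + 1) else 5 * (z : ZMod (Nm m)).val)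
      = 5 * w := by
    rw [hw, Nm_succ]
    split_ifs <;> omega
  have : Fact (Nat.Prime 5) := ⟨by norm_num⟩
  have hp : padicValNat 5 (5 * w) = padicValNat 5 w + 1 := by
    rw [padicValNat.mul (by norm_num) hw0, padicValNat_self, add_comm]
  simp only [hv, hp]
  have hd : 5 * w / 5 ^ (padicValNat 5 w + 1) = w / 5 ^ padicValNat 5 w := by
    rw [pow_succ', Nat.mul_div_mul_left _ _ (by norm_num)]
  rw [hd]
  split_ifs <;> ring

lemma partnerInt_five_mul_add (m : ℕ) (z r : ℤ) (hr0 : 0 < r) (hr : r < 5) :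
    partnerInt (m + 1) (5 * z + r) =
      if r = 1 ∨ r = 3 then 5 * z + r + 1 else 5 * z + r - 1 := by
  have hval := val_intCast_five_mul_add m z r hr0.le hr
  unfold partnerInt
  set x := ((5 * z + r : ℤ) : ZMod (Nm (m + 1))).val
  have hx0 : x ≠ 0 := by omega
  have hk : padicValNat 5 x = 0 := by
    apply padicValNat.eq_zero_of_not_dvd
    omega
  simp only [hx0, if_false, hk, pow_zero, Nat.div_one]
  split_ifs <;> first | rfl | omega

lemma extFun_intCast (m : ℕ) (l : ℝ) (u : ZMod (Nm m) → ℝ) (z r : ℤ)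
    (hr0 : 0 ≤ r) (hr : r < 5) :
    extFun m l u ((5 * z + r : ℤ) : ZMod (Nm (m + 1))) =
      if r = 0 then u (z : ZMod (Nm m)) else if r = 1 ∨ r = 2 then
        ((2 - l) * u (z : ZMod (Nm m)) + u ((z + 1 : ℤ) : ZMod (Nm m))) / ((1 - l) * (3 - l))
      else (u (z : ZMod (Nm m)) + (2 - l) * u ((z + 1 : ℤ) : ZMod (Nm m)))
        / ((1 - l) * (3 - l)) := by
  have hval := val_intCast_five_mul_add m z r hr0 hr
  unfold extFun
  set x := ((5 * z + r : ℤ) : ZMod (Nm (m + 1))).val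
  have hdiv : x / 5 = (z : ZMod (Nm m)).val := by omega
  have hmod : ((x % 5 : ℕ) : ℤ) = r := by omega
  simp only [hdiv, ZMod.natCast_val, ZMod.cast_id', id_eq, Int.cast_add, Int.cast_one]
  have e0 : x % 5 = 0 ↔ r = 0 := by omega
  have e1 : (x % 5 = 1 ∨ x % 5 = 2) ↔ (r = 1 ∨ r = 2) := by omega
  simp only [e0, e1]

lemma exists_five_mul_add (w : ℤ) : ∃ z r : ℤ, 0 ≤ r ∧ r < 5 ∧ w = 5 * z + r :=
  ⟨w / 5, w % 5, by omega, by omega, by omega⟩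

section Extension

variable {m : ℕ} {l : ℝ} {u : ZMod (Nm m) → ℝ}

lemma extFun_five_mul (z : ℤ) :
    extFun m l u ((5 * z : ℤ) : ZMod (Nm (m + 1))) = u (z : ZMod (Nm m)) := by
  have := extFun_intCast m l u z 0 le_rfl (by norm_num)
  rwa [add_zero, if_pos rfl] at this

lemma IsKFun.extFun (hu : IsKFun m u) : IsKFun (m + 1) (extFun m l u) := by
  intro n
  obtain ⟨w, rfl⟩ := ZMod.intCast_surjective n
  obtain ⟨z, r, hr0, hr, rfl⟩ := exists_five_mul_add w
  rw [partner_intCast]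
  rcases hr0.eq_or_lt with h | h
  · subst h
    rw [add_zero, partnerInt_five_mul, extFun_five_mul, extFun_five_mul, ← partner_intCast, hu]
  · rw [partnerInt_five_mul_add m z r h hr]
    have : r = 1 ∨ r = 2 ∨ r = 3 ∨ r = 4 := by omega
    rcases this with rfl | rfl | rfl | rfl
    · rw [if_pos (by norm_num), add_assoc, extFun_intCast _ _ _ _ _ (by norm_num) (by norm_num),
        extFun_intCast _ _ _ _ _ (by norm_num) (by norm_num)]
      norm_num
    · rw [if_neg (by norm_num), add_sub_assoc,
        extFun_intCast _ _ _ _ _ (by norm_num) (by norm_num),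
        extFun_intCast _ _ _ _ _ (by norm_num) (by norm_num)]
      norm_num
    · rw [if_pos (by norm_num), add_assoc, extFun_intCast _ _ _ _ _ (by norm_num) (by norm_num),
        extFun_intCast _ _ _ _ _ (by norm_num) (by norm_num)]
      norm_num
    · rw [if_neg (by norm_num), add_sub_assoc,
        extFun_intCast _ _ _ _ _ (by norm_num) (by norm_num),
        extFun_intCast _ _ _ _ _ (by norm_num) (by norm_num)]
      norm_num

lemma lap_intCast (z : ℤ) :
    lap m u (z : ZMod (Nm m)) = 4 * u (z : ZMod (Nm m)) - u ((z + 1 : ℤ) : ZMod (Nm m))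
      - u ((z - 1 : ℤ) : ZMod (Nm m)) - u ((partnerInt m z + 1 : ℤ) : ZMod (Nm m))
      - u ((partnerInt m z - 1 : ℤ) : ZMod (Nm m)) := by
  unfold lap
  rw [partner_intCast]
  push_cast
  rfl

lemma extFun_five_mul_add_one (z : ℤ) :
    extFun m l u ((5 * z + 1 : ℤ) : ZMod (Nm (m + 1))) =
      ((2 - l) * u (z : ZMod (Nm m)) + u ((z + 1 : ℤ) : ZMod (Nm m)))
        / ((1 - l) * (3 - l)) := by
  rw [extFun_intCast _ _ _ _ _ (by norm_num) (by norm_num)]; norm_num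

lemma extFun_five_mul_add_two (z : ℤ) :
    extFun m l u ((5 * z + 2 : ℤ) : ZMod (Nm (m + 1))) =
      ((2 - l) * u (z : ZMod (Nm m)) + u ((z + 1 : ℤ) : ZMod (Nm m)))
        / ((1 - l) * (3 - l)) := by
  rw [extFun_intCast _ _ _ _ _ (by norm_num) (by norm_num)]; norm_num

lemma extFun_five_mul_add_three (z : ℤ) :
    extFun m l u ((5 * z + 3 : ℤ) : ZMod (Nm (m + 1))) =
      (u (z : ZMod (Nm m)) + (2 - l) * u ((z + 1 : ℤ) : ZMod (Nm m)))
        / ((1 - l) * (3 - l)) := by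
  rw [extFun_intCast _ _ _ _ _ (by norm_num) (by norm_num)]; norm_num

lemma extFun_five_mul_add_four (z : ℤ) :
    extFun m l u ((5 * z + 4 : ℤ) : ZMod (Nm (m + 1))) =
      (u (z : ZMod (Nm m)) + (2 - l) * u ((z + 1 : ℤ) : ZMod (Nm m)))
        / ((1 - l) * (3 - l)) := by
  rw [extFun_intCast _ _ _ _ _ (by norm_num) (by norm_num)]; norm_num

lemma extFun_five_mul_sub_one (z : ℤ) :
    extFun m l u ((5 * z - 1 : ℤ) : ZMod (Nm (m + 1))) =
      (u ((z - 1 : ℤ) : ZMod (Nm m)) + (2 - l) * u (z : ZMod (Nm m)))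
        / ((1 - l) * (3 - l)) := by
  have := extFun_five_mul_add_four (l := l) (u := u) (z - 1)
  rwa [show 5 * (z - 1) + 4 = 5 * z - 1 by ring, show z - 1 + 1 = z by ring] at this

lemma lap_extFun (hu : IsKFun m u) (hl1 : l ≠ 1) (hl3 : l ≠ 3)
    (he : ∀ n, lap m u n = R l * u n) (n : ZMod (Nm (m + 1))) :
    lap (m + 1) (extFun m l u) n = l * extFun m l u n := by
  have h1 : (1 - l) ≠ 0 := sub_ne_zero.2 hl1.symm
  have h3 : (3 - l) ≠ 0 := sub_ne_zero.2 hl3.symm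
  obtain ⟨w, rfl⟩ := ZMod.intCast_surjective n
  obtain ⟨z, r, hr0, hr, rfl⟩ := exists_five_mul_add w
  rw [lap_intCast]
  have hcases : r = 0 ∨ r = 1 ∨ r = 2 ∨ r = 3 ∨ r = 4 := by omega
  rcases hcases with rfl | rfl | rfl | rfl | rfl
  · rw [add_zero, partnerInt_five_mul, extFun_five_mul, extFun_five_mul_add_one,
      extFun_five_mul_sub_one, extFun_five_mul_add_one, extFun_five_mul_sub_one]
    have hz := he (z : ZMod (Nm m))
    rw [lap_intCast] at hz
    have hp : u ((partnerInt m z : ℤ) : ZMod (Nm m)) = u (z : ZMod (Nm m)) := by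
      rw [← partner_intCast, hu]
    rw [hp]
    field_simp
    unfold R at hz
    linear_combination hz
  · rw [partnerInt_five_mul_add m z 1 (by norm_num) (by norm_num), if_pos (by norm_num),
      show 5 * z + 1 + 1 = 5 * z + 2 by ring, show 5 * z + 1 - 1 = 5 * z by ring,
      show 5 * z + 2 + 1 = 5 * z + 3 by ring, show 5 * z + 2 - 1 = 5 * z + 1 by ring,
      extFun_five_mul, extFun_five_mul_add_one, extFun_five_mul_add_two,
      extFun_five_mul_add_three]
    field_simp
    ring
  · rw [partnerInt_five_mul_add m z 2 (by norm_num) (by norm_num), if_neg (by norm_num),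
      show 5 * z + 2 - 1 = 5 * z + 1 by ring, show 5 * z + 1 - 1 = 5 * z by ring,
      show 5 * z + 2 + 1 = 5 * z + 3 by ring, show 5 * z + 1 + 1 = 5 * z + 2 by ring,
      extFun_five_mul, extFun_five_mul_add_one, extFun_five_mul_add_two,
      extFun_five_mul_add_three]
    field_simp
    ring
  · rw [partnerInt_five_mul_add m z 3 (by norm_num) (by norm_num), if_pos (by norm_num),
      show 5 * z + 3 + 1 = 5 * z + 4 by ring, show 5 * z + 3 - 1 = 5 * z + 2 by ring,
      show 5 * z + 4 + 1 = 5 * (z + 1) by ring, show 5 * z + 4 - 1 = 5 * z + 3 by ring,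
      extFun_five_mul, extFun_five_mul_add_two, extFun_five_mul_add_three,
      extFun_five_mul_add_four]
    field_simp
    ring
  · rw [partnerInt_five_mul_add m z 4 (by norm_num) (by norm_num), if_neg (by norm_num),
      show 5 * z + 4 - 1 = 5 * z + 3 by ring, show 5 * z + 3 - 1 = 5 * z + 2 by ring,
      show 5 * z + 4 + 1 = 5 * (z + 1) by ring, show 5 * z + 3 + 1 = 5 * z + 4 by ring,
      extFun_five_mul, extFun_five_mul_add_two, extFun_five_mul_add_three,
      extFun_five_mul_add_four]
    field_simp
    ring

lemma IsEigen.extFun (hl1 : l ≠ 1) (hl3 : l ≠ 3) (hu : IsEigen m (R l) u) :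
    IsEigen (m + 1) l (extFun m l u) := by
  obtain ⟨hk, hne, he⟩ := hu
  refine ⟨hk.extFun, fun h0 => hne ?_, lap_extFun hk hl1 hl3 he⟩
  funext n
  obtain ⟨z, rfl⟩ := ZMod.intCast_surjective n
  rw [← extFun_five_mul (l := l) (u := u) z, h0]
  rfl

end Extension

lemma partner_one {m : ℕ} (hm : 1 ≤ m) : partner m 1 = 2 := by
  obtain ⟨k, rfl⟩ := Nat.exists_eq_add_of_le' hm
  have h := partner_intCast (k + 1) (5 * 0 + 1)
  rw [partnerInt_five_mul_add k 0 1 (by norm_num) (by norm_num), if_pos (by norm_num)] at h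
  norm_num at h
  exact h

/-- Eigenvalues of `−Δ_m` lie in `[0, 8)`. -/
lemma IsEigen.mem_Ico {m : ℕ} (hm : 1 ≤ m) {l : ℝ} {u : ZMod (Nm m) → ℝ}
    (hu : IsEigen m l u) : 0 ≤ l ∧ l < 8 := by
  obtain ⟨hk, hne, he⟩ := hu
  obtain ⟨x, hx⟩ := Finite.exists_max (fun n => |u n|)
  have hpos : 0 < |u x| := by
    obtain ⟨y, hy⟩ := Function.ne_iff.1 hne
    exact (abs_pos.2 hy).trans_le (hx y)
  have key : ∀ n, (4 - l) * u n =
      u (n + 1) + u (n - 1) + u (partner m n + 1) + u (partner m n - 1) := by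
    intro n
    have := he n
    unfold lap at this
    linarith
  have hb : ∀ n, -|u x| ≤ u n ∧ u n ≤ |u x| := fun n => abs_le.1 (hx n)
  have hle : |4 - l| * |u x| ≤ 4 * |u x| := by
    rw [← abs_mul, key x, abs_le]
    constructor <;>
    linarith [hb (x + 1), hb (x - 1), hb (partner m x + 1), hb (partner m x - 1)]
  have h4 := abs_le.1 (le_of_mul_le_mul_right hle hpos)
  refine ⟨by linarith, lt_of_le_of_ne (by linarith) ?_⟩
  rintro rfl
  have step : ∀ n, |u n| = |u x| → u (n + 1) = - u n := by
    intro n hn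
    have h1 := key n
    have a1 := hb (n + 1)
    have a2 := hb (n - 1)
    have a3 := hb (partner m n + 1)
    have a4 := hb (partner m n - 1)
    rw [← hn] at a1 a2 a3 a4
    rcases abs_cases (u n) with ⟨h, _⟩ | ⟨h, _⟩ <;> rw [h] at a1 a2 a3 a4 <;> linarith
  have all : ∀ k : ℕ, |u (x + k)| = |u x| := by
    intro k
    induction k with
    | zero => simp
    | succ k ih =>
      have := step _ ih
      push_cast
      rw [← add_assoc, this, abs_neg, ih]
  have h1 : |u 1| = |u x| := by
    have := all (1 - x).val
    rwa [ZMod.natCast_val, ZMod.cast_id', id_eq, add_sub_cancel] at this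
  have h2 := step 1 h1
  have h3 := hk 1
  rw [partner_one hm] at h3
  rw [one_add_one_eq_two, h3] at h2
  have : u 1 = 0 := by linarith
  rw [this, abs_zero] at h1
  linarith

lemma phi1_spec {y : ℝ} (h0 : 0 ≤ y) (h8 : y < 8) :
    0 ≤ phi1 y ∧ phi1 y < 1 ∧ R (phi1 y) = y := by
  have hs1 : (4 : ℝ) ≤ √19 := Real.le_sqrt_of_sq_le (by norm_num)
  have hs2 : √19 ≤ 5 := Real.sqrt_le_iff.2 (by norm_num)
  have hR : ContinuousOn R (Set.Icc 0 1) := by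
    unfold R; fun_prop
  have hmem : y ∈ Set.Icc (R 0) (R 1) := by
    unfold R; constructor <;> norm_num <;> linarith
  obtain ⟨x, hx, hxy⟩ := intermediate_value_Icc zero_le_one hR hmem
  have hex : ∃ a ∈ Set.Icc 0 cpt, R a = y :=
    ⟨x, ⟨hx.1, hx.2.trans (by unfold cpt; linarith)⟩, hxy⟩
  obtain ⟨⟨h1, h2⟩, h3⟩ := Function.invFunOn_pos hex
  change 0 ≤ phi1 y at h1
  change phi1 y ≤ cpt at h2
  change R (phi1 y) = y at h3
  refine ⟨h1, ?_, h3⟩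
  by_contra! hge
  have h4 : phi1 y ≤ 4 / 3 := h2.trans (by unfold cpt; linarith)
  unfold R at h3
  nlinarith [mul_nonneg (sub_nonneg.2 hge) (mul_nonneg (sub_nonneg.2 hge) (sub_nonneg.2 h4)),
    mul_nonneg (sub_nonneg.2 hge) (sub_nonneg.2 h4)]

/-- The orbit of eigenvalues under the inverse branch `phi1`. -/
lemma orbit_spec {L : ℕ → ℝ} (h0 : 0 ≤ L 0) (h8 : L 0 < 8) (hL : ∀ j, L (j + 1) = phi1 (L j))
    (j : ℕ) : 0 ≤ L (j + 1) ∧ L (j + 1) < 1 ∧ R (L (j + 1)) = L j := by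
  induction j with
  | zero => rw [hL]; exact phi1_spec h0 h8
  | succ j ih => rw [hL (j + 1)]; exact phi1_spec ih.1 (by linarith [ih.2.1])

lemma orbit_le {L : ℕ → ℝ} (h0 : 0 ≤ L 0) (h8 : L 0 < 8) (hL : ∀ j, L (j + 1) = phi1 (L j))
    (j : ℕ) : L (j + 1) ≤ (1 / 8) ^ j := by
  induction j with
  | zero => simpa using (orbit_spec h0 h8 hL 0).2.1.le
  | succ j ih =>
    obtain ⟨h1, h2, h3⟩ := orbit_spec h0 h8 hL (j + 1)
    unfold R at h3
    rw [pow_succ]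
    nlinarith [mul_nonneg h1 (mul_nonneg (sub_nonneg.2 h2.le)
      (by linarith : (0 : ℝ) ≤ 7 - L (j + 1 + 1)))]

lemma orbit_tendsto {L : ℕ → ℝ} (h0 : 0 ≤ L 0) (h8 : L 0 < 8)
    (hL : ∀ j, L (j + 1) = phi1 (L j)) (m₀ : ℕ) :
    ∃ lam, Filter.Tendsto (fun j => (15 : ℝ) ^ (m₀ + j) * L j) Filter.atTop (nhds lam) := by
  refine cauchySeq_tendsto_of_complete
    (cauchySeq_of_le_geometric (15 / 64) (8 * 15 ^ m₀) (by norm_num) fun j => ?_)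
  obtain ⟨h1, h2, h3⟩ := orbit_spec h0 h8 hL j
  have h4 := orbit_le h0 h8 hL j
  set x := L (j + 1)
  have hsq : x ^ 2 ≤ (1 / 64) ^ j := by
    calc x ^ 2 ≤ ((1 / 8) ^ j) ^ 2 := by gcongr
      _ = (1 / 64) ^ j := by rw [← pow_mul, mul_comm, pow_mul]; norm_num
  have hdist : (15 : ℝ) ^ (m₀ + (j + 1)) * x - 15 ^ (m₀ + j) * L j
      = 15 ^ (m₀ + j) * (8 * x ^ 2 - x ^ 3) := by
    rw [← h3]; unfold R; ring
  have hnn : 0 ≤ 8 * x ^ 2 - x ^ 3 := by nlinarith [sq_nonneg x]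
  rw [dist_comm, Real.dist_eq, hdist, abs_of_nonneg (by positivity)]
  calc (15 : ℝ) ^ (m₀ + j) * (8 * x ^ 2 - x ^ 3) ≤ 15 ^ (m₀ + j) * (8 * (1 / 64) ^ j) := by
        gcongr
        nlinarith [pow_nonneg h1 3]
    _ = 8 * 15 ^ m₀ * (15 / 64) ^ j := by
        rw [pow_add, div_pow, div_pow, one_pow]; ring

section Refinement

variable {a b l B d : ℝ}

lemma abs_extension_value_le (h1 : l ≤ 1 / 8) (ha : |a| ≤ B) (hb : |b| ≤ B) :
    |((2 - l) * a + b) / ((1 - l) * (3 - l))| ≤ B * (8 / 7) := by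
  have hD : 0 < (1 - l) * (3 - l) := mul_pos (by linarith) (by linarith)
  have hB : 0 ≤ B := (abs_nonneg a).trans ha
  rw [abs_div, abs_of_pos hD, div_le_iff₀ hD]
  calc |(2 - l) * a + b| ≤ (2 - l) * |a| + |b| := by
        refine (abs_add_le _ _).trans ?_
        rw [abs_mul, abs_of_nonneg (by linarith : (0 : ℝ) ≤ 2 - l)]
    _ ≤ (2 - l) * B + B := by gcongr; linarith
    _ ≤ B * (8 / 7) * ((1 - l) * (3 - l)) := by
        nlinarith [mul_nonneg hB (mul_nonneg (by linarith : (0 : ℝ) ≤ 1 / 8 - l)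
          (by linarith : (0 : ℝ) ≤ 3 - l))]

lemma abs_extension_value_sub_le (h0 : 0 ≤ l) (h1 : l ≤ 1 / 8) (ha : |a| ≤ B)
    (hd : |b - a| ≤ d) :
    |((2 - l) * a + b) / ((1 - l) * (3 - l)) - a| ≤ (d + 3 * l * B) / (5 / 2) := by
  have hD : 5 / 2 ≤ (1 - l) * (3 - l) := by nlinarith
  have hB : 0 ≤ B := (abs_nonneg a).trans ha
  have hd0 : 0 ≤ d := (abs_nonneg _).trans hd
  have : ((2 - l) * a + b) / ((1 - l) * (3 - l)) - a
      = ((b - a) + (3 * l - l ^ 2) * a) / ((1 - l) * (3 - l)) := by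
    rw [div_sub' (by linarith)]; ring
  rw [this, abs_div, abs_of_pos (by linarith : 0 < (1 - l) * (3 - l))]
  gcongr
  refine (abs_add_le _ _).trans (add_le_add hd ?_)
  rw [abs_mul, abs_of_nonneg (by nlinarith : 0 ≤ 3 * l - l ^ 2)]
  gcongr
  nlinarith

lemma abs_extension_values_sub_le (h1 : l ≤ 1 / 8) (hd : |b - a| ≤ d) :
    |(a + (2 - l) * b) / ((1 - l) * (3 - l)) - ((2 - l) * a + b) / ((1 - l) * (3 - l))|
      ≤ d / (5 / 2) := by
  have hd0 : 0 ≤ d := (abs_nonneg _).trans hd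
  have h2 : 1 - l ≠ 0 := by linarith
  have h3 : 3 - l ≠ 0 := by linarith
  have : (a + (2 - l) * b) / ((1 - l) * (3 - l)) - ((2 - l) * a + b) / ((1 - l) * (3 - l))
      = (b - a) / (3 - l) := by
    field_simp; ring
  rw [this, abs_div, abs_of_pos (by linarith : 0 < 3 - l)]
  gcongr
  linarith

end Refinement

lemma abs_extFun_le {m : ℕ} {l B : ℝ} {u : ZMod (Nm m) → ℝ} (h1 : l ≤ 1 / 8)
    (hB : ∀ n, |u n| ≤ B) (n : ZMod (Nm (m + 1))) : |extFun m l u n| ≤ B * (8 / 7) := by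
  obtain ⟨w, rfl⟩ := ZMod.intCast_surjective n
  obtain ⟨z, r, hr0, hr, rfl⟩ := exists_five_mul_add w
  rw [extFun_intCast _ _ _ _ _ hr0 hr]
  have := (abs_nonneg _).trans (hB 0)
  split_ifs
  · linarith [hB z]
  · exact abs_extension_value_le h1 (hB _) (hB _)
  · rw [add_comm (u z)]
    exact abs_extension_value_le h1 (hB _) (hB _)

lemma abs_extFun_add_one_sub_le {m : ℕ} {l B d : ℝ} {u : ZMod (Nm m) → ℝ} (h0 : 0 ≤ l)
    (h1 : l ≤ 1 / 8) (hB : ∀ n, |u n| ≤ B) (hd : ∀ n, |u (n + 1) - u n| ≤ d)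
    (n : ZMod (Nm (m + 1))) :
    |extFun m l u (n + 1) - extFun m l u n| ≤ (d + 3 * l * B) / (5 / 2) := by
  obtain ⟨w, rfl⟩ := ZMod.intCast_surjective n
  obtain ⟨z, r, hr0, hr, rfl⟩ := exists_five_mul_add w
  have hB0 := (abs_nonneg _).trans (hB 0)
  have hd0 := (abs_nonneg _).trans (hd 0)
  have hlB : 0 ≤ l * B := by positivity
  have hz : |u ((z + 1 : ℤ) : ZMod (Nm m)) - u (z : ZMod (Nm m))| ≤ d := by
    have := hd z
    push_cast
    exact this
  have hcast : ∀ y : ℤ, ((y : ℤ) : ZMod (Nm (m + 1))) + 1 = ((y + 1 : ℤ) : ZMod (Nm (m + 1))) := by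
    intro y; push_cast; rfl
  rw [hcast]
  have hcases : r = 0 ∨ r = 1 ∨ r = 2 ∨ r = 3 ∨ r = 4 := by omega
  rcases hcases with rfl | rfl | rfl | rfl | rfl
  · rw [add_zero, extFun_five_mul, extFun_five_mul_add_one]
    exact abs_extension_value_sub_le h0 h1 (hB _) hz
  · rw [show 5 * z + 1 + 1 = 5 * z + 2 by ring, extFun_five_mul_add_one, extFun_five_mul_add_two,
      sub_self, abs_zero]
    positivity
  · rw [show 5 * z + 2 + 1 = 5 * z + 3 by ring, extFun_five_mul_add_two,
      extFun_five_mul_add_three]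
    exact (abs_extension_values_sub_le h1 hz).trans (by gcongr; linarith)
  · rw [show 5 * z + 3 + 1 = 5 * z + 4 by ring, extFun_five_mul_add_three,
      extFun_five_mul_add_four, sub_self, abs_zero]
    positivity
  · rw [show 5 * z + 4 + 1 = 5 * (z + 1) by ring, extFun_five_mul, extFun_five_mul_add_four,
      abs_sub_comm, add_comm (u z)]
    exact abs_extension_value_sub_le h0 h1 (hB _) (by rwa [abs_sub_comm])

/-- The oscillation of iterated extensions decays geometrically. -/
lemma exists_osc_bound {m₀ : ℕ} {L : ℕ → ℝ} (h0 : 0 ≤ L 0) (h8 : L 0 < 8)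
    (hL : ∀ j, L (j + 1) = phi1 (L j)) (u : ∀ j, ZMod (Nm (m₀ + j)) → ℝ)
    (hu : ∀ j, u (j + 1) = extFun (m₀ + j) (L (j + 1)) (u j)) :
    ∃ C : ℝ, ∀ j n, |u j (n + 1) - u j n| ≤ C * (1 / 2) ^ j := by
  obtain ⟨x, hx⟩ := Finite.exists_max (fun n => |u 0 n|)
  obtain ⟨y, hy⟩ := Finite.exists_max (fun n => |u 1 n|)
  set B := max |u 0 x| |u 1 y|
  have hB0 : 0 ≤ B := (abs_nonneg _).trans (le_max_left _ _)
  have hb0 : ∀ n, |u 0 n| ≤ B := fun n => (hx n).trans (le_max_left _ _)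
  have hb1 : ∀ n, |u 1 n| ≤ B := fun n => (hy n).trans (le_max_right _ _)
  have hLle : ∀ j, 0 ≤ L (j + 2) ∧ L (j + 2) ≤ (1 / 8) ^ (j + 1) ∧ L (j + 2) ≤ 1 / 8 := by
    intro j
    have h := orbit_le h0 h8 hL (j + 1)
    refine ⟨(orbit_spec h0 h8 hL (j + 1)).1, h, h.trans ?_⟩
    exact (pow_le_pow_of_le_one (by norm_num) (by norm_num) (by omega : 1 ≤ j + 1)).trans
      (by norm_num)
  have hbound : ∀ j n, |u (j + 1) n| ≤ B * (8 / 7) ^ j := by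
    intro j
    induction j with
    | zero => simpa using hb1
    | succ j ih =>
      rw [hu (j + 1), pow_succ, ← mul_assoc]
      exact abs_extFun_le (hLle j).2.2 ih
  have htri : ∀ (p q : ℝ), |p| ≤ B → |q| ≤ B → |p - q| ≤ 2 * B := fun p q hp hq =>
    (abs_sub _ _).trans (by linarith)
  have hosc : ∀ j n, |u (j + 1) (n + 1) - u (j + 1) n| ≤ 12 * B * (1 / 2) ^ (j + 1) := by
    intro j
    induction j with
    | zero => exact fun n => (htri _ _ (hb1 _) (hb1 _)).trans (by linarith)
    | succ j ih =>
      intro n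
      have h := abs_extFun_add_one_sub_le (hLle j).1 (hLle j).2.2 (hbound j) ih n
      rw [← hu (j + 1)] at h
      refine h.trans ?_
      have h1 : L (j + 2) * (B * (8 / 7) ^ j) ≤ B * (1 / 2) ^ (j + 1) := by
        calc L (j + 2) * (B * (8 / 7) ^ j) ≤ (1 / 8) ^ (j + 1) * (B * (8 / 7) ^ j) := by
              gcongr; exact (hLle j).2.1
          _ = B * ((1 / 8) * (1 / 7) ^ j) := by
              rw [pow_succ, show (1 / 7 : ℝ) = 1 / 8 * (8 / 7) by norm_num, mul_pow]
              ring
          _ ≤ B * ((1 / 2) * (1 / 2) ^ j) := by gcongr <;> norm_num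
          _ = B * (1 / 2) ^ (j + 1) := by rw [pow_succ']
      rw [pow_succ (1 / 2 : ℝ) (j + 1)]
      linarith
  refine ⟨12 * B, fun j n => ?_⟩
  cases j with
  | zero => exact (htri _ _ (hb0 _) (hb0 _)).trans (by rw [pow_zero]; linarith)
  | succ j => exact hosc j n

lemma floor_five_mul (y : ℝ) : ∃ r : ℕ, r < 5 ∧ ⌊5 * y⌋ = 5 * ⌊y⌋ + r := by
  have h1 := Int.floor_le y
  have h2 := Int.lt_floor_add_one y
  have h3 : 5 * ⌊y⌋ ≤ ⌊5 * y⌋ := Int.le_floor.2 (by push_cast; linarith)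
  have h4 : ⌊5 * y⌋ < 5 * ⌊y⌋ + 5 := Int.floor_lt.2 (by push_cast; linarith)
  exact ⟨(⌊5 * y⌋ - 5 * ⌊y⌋).toNat, by omega, by omega⟩

/-- A compatible family on the nested grids with geometrically decaying oscillation extends to a
continuous function on the circle. -/
lemma exists_continuous_of_osc {N : ℕ → ℕ} (hN : ∀ j, 0 < N j) (hN5 : ∀ j, N (j + 1) = 5 * N j)
    {g : ℕ → ℤ → ℝ} (hper : ∀ j z, g j (z + N j) = g j z)
    (hcomp : ∀ j z, g (j + 1) (5 * z) = g j z) {C : ℝ}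
    (hosc : ∀ j z, |g j (z + 1) - g j z| ≤ C * (1 / 2) ^ j) :
    ∃ u : AddCircle (1 : ℝ) → ℝ, Continuous u ∧
      ∀ j (z : ℤ), u ((z / N j : ℝ) : AddCircle (1 : ℝ)) = g j z := by
  have hC : 0 ≤ C := by simpa using (abs_nonneg _).trans (hosc 0 0)
  have hNpos : ∀ j, (0 : ℝ) < N j := fun j => by exact_mod_cast hN j
  set f : ℕ → ℝ → ℝ := fun j x => g j ⌊N j * x⌋ with hf
  have hiter : ∀ j z (r : ℕ), |g j (z + r) - g j z| ≤ r * (C * (1 / 2) ^ j) := by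
    intro j z r
    induction r with
    | zero => simp
    | succ r ih =>
      have h1 := hosc j (z + r)
      have h2 := abs_sub_le (g j (z + r + 1)) (g j (z + r)) (g j z)
      push_cast
      rw [← add_assoc]
      linarith
  have hstep : ∀ x j, dist (f j x) (f (j + 1) x) ≤ 2 * C * (1 / 2) ^ j := by
    intro x j
    obtain ⟨r, hr, hfl⟩ := floor_five_mul (N j * x)
    have h1 : f (j + 1) x = g (j + 1) (5 * ⌊N j * x⌋ + r) := by
      simp only [hf]
      rw [hN5, ← hfl]
      push_cast
      rw [mul_assoc]
    rw [dist_comm, Real.dist_eq, h1]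
    simp only [hf]
    rw [← hcomp j ⌊N j * x⌋]
    refine (hiter _ _ _).trans ?_
    have : (r : ℝ) ≤ 4 := by exact_mod_cast (by omega : r ≤ 4)
    rw [pow_succ]
    have : (r : ℝ) * (C * ((1 / 2) ^ j * (1 / 2))) ≤ 4 * (C * ((1 / 2) ^ j * (1 / 2))) := by
      gcongr
    linarith
  choose F hF using fun x => cauchySeq_tendsto_of_complete
    (cauchySeq_of_le_geometric (1 / 2) (2 * C) (by norm_num) (hstep x))
  have happrox : ∀ x j, |f j x - F x| ≤ 4 * C * (1 / 2) ^ j := by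
    intro x j
    have := dist_le_of_le_geometric_of_tendsto (1 / 2) (2 * C) (by norm_num) (hstep x) (hF x) j
    rw [Real.dist_eq] at this
    refine this.trans_eq ?_
    ring
  have hfper : ∀ j x, f j (x + 1) = f j x := by
    intro j x
    simp only [hf]
    rw [mul_add, mul_one, ← Int.cast_natCast (R := ℝ) (N j), Int.floor_add_intCast, hper]
  have hFper : Function.Periodic F 1 := fun x =>
    tendsto_nhds_unique (hF (x + 1)) ((hF x).congr fun j => (hfper j x).symm)
  have hval : ∀ j (z : ℤ), F (z / N j) = g j z := by
    intro j z
    have hk : ∀ k, f (j + k) (z / N j) = g j z := by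
      intro k
      have hNk : ∀ k, N (j + k) = 5 ^ k * N j := by
        intro k
        induction k with
        | zero => simp
        | succ k ih => rw [← add_assoc, hN5, ih, pow_succ]; ring
      have hgk : ∀ k, g (j + k) (5 ^ k * z) = g j z := by
        intro k
        induction k with
        | zero => simp
        | succ k ih => rw [← add_assoc, pow_succ', mul_assoc, hcomp, ih]
      have : (N (j + k) : ℝ) * (z / N j) = ((5 ^ k * z : ℤ) : ℝ) := by
        rw [hNk]
        have := (hNpos j).ne'
        push_cast
        field_simp
      simp only [hf]
      rw [this, Int.floor_intCast, hgk]
    refine tendsto_nhds_unique ((hF _).comp (Filter.tendsto_add_atTop_nat j)) ?_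
    refine tendsto_const_nhds.congr fun k => ?_
    simp only [Function.comp]
    rw [add_comm, hk]
  have hcont : Continuous F := by
    rw [Metric.continuous_iff]
    intro x ε hε
    have hlim : Filter.Tendsto (fun j : ℕ => 9 * C * (1 / 2 : ℝ) ^ j) Filter.atTop (nhds 0) := by
      simpa using (tendsto_pow_atTop_nhds_zero_of_lt_one (by norm_num : (0 : ℝ) ≤ 1 / 2)
        (by norm_num)).const_mul (9 * C)
    obtain ⟨j, hj⟩ := (hlim.eventually (gt_mem_nhds hε)).exists
    refine ⟨1 / N j, one_div_pos.2 (hNpos j), fun y hy => ?_⟩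
    have hnear : |f j y - f j x| ≤ C * (1 / 2) ^ j := by
      rw [Real.dist_eq, lt_div_iff₀ (hNpos j)] at hy
      have hy' : |(y - x) * N j| < 1 := by rwa [abs_mul, abs_of_pos (hNpos j)]
      rw [abs_lt] at hy'
      have a1 := Int.floor_le (N j * x)
      have a2 := Int.lt_floor_add_one (N j * x)
      have a3 := Int.floor_le (N j * y)
      have a4 := Int.lt_floor_add_one (N j * y)
      have b1 : ⌊N j * x⌋ < ⌊N j * y⌋ + 2 := by
        rify; linarith
      have b2 : ⌊N j * y⌋ < ⌊N j * x⌋ + 2 := by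
        rify; linarith
      have : ⌊N j * y⌋ = ⌊N j * x⌋ ∨ ⌊N j * y⌋ = ⌊N j * x⌋ + 1 ∨ ⌊N j * x⌋ = ⌊N j * y⌋ + 1 := by
        omega
      simp only [hf]
      rcases this with h | h | h
      · rw [h, sub_self, abs_zero]; positivity
      · rw [h]; exact hosc _ _
      · rw [h, abs_sub_comm]; exact hosc _ _
    rw [Real.dist_eq]
    have c1 := happrox x j
    have c2 := happrox y j
    rw [abs_le] at c1 c2 hnear
    refine lt_of_le_of_lt (abs_le.2 ⟨?_, ?_⟩) hj <;> linarith
  exact ⟨hFper.lift, continuous_coinduced_dom.2 hcont, fun j z => hval j z⟩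

lemma restr_intCast (u : AddCircle (1 : ℝ) → ℝ) (m : ℕ) (z : ℤ) :
    restr u m (z : ZMod (Nm m)) = u ((z / Nm m : ℝ) : AddCircle (1 : ℝ)) := by
  unfold restr
  congr 1
  have h : (((z : ZMod (Nm m)).val : ℕ) : ℤ) = z - Nm m * (z / Nm m) := by
    rw [ZMod.val_intCast, Int.emod_def]
  have h' : (((z : ZMod (Nm m)).val : ℕ) : ℝ) = z - Nm m * ((z / Nm m : ℤ) : ℝ) := by
    exact_mod_cast h
  have hpos : (Nm m : ℝ) ≠ 0 := by exact_mod_cast (Nm_pos m).ne'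
  rw [h', sub_div, mul_div_cancel_left₀ _ hpos, AddCircle.coe_sub]
  have : (((z / Nm m : ℤ) : ℝ) : AddCircle (1 : ℝ)) = 0 :=
    (AddCircle.coe_eq_zero_iff 1).2 ⟨z / Nm m, by simp⟩
  rw [this, sub_zero]

lemma restr_five_mul (u : AddCircle (1 : ℝ) → ℝ) (m : ℕ) (z : ℤ) :
    restr u (m + 1) ((5 * z : ℤ) : ZMod (Nm (m + 1))) = restr u m (z : ZMod (Nm m)) := by
  rw [restr_intCast, restr_intCast, Nm_succ]
  push_cast
  rw [mul_div_mul_left _ _ (by norm_num)]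

lemma isKFun_restr_of_succ {u : AddCircle (1 : ℝ) → ℝ} {m : ℕ}
    (h : IsKFun (m + 1) (restr u (m + 1))) : IsKFun m (restr u m) := by
  intro n
  obtain ⟨z, rfl⟩ := ZMod.intCast_surjective n
  rw [partner_intCast, ← restr_five_mul u m z, ← restr_five_mul, ← partnerInt_five_mul,
    ← partner_intCast, h]

lemma admissible_of_isKFun {u : AddCircle (1 : ℝ) → ℝ} (hu : Continuous u) (m₀ : ℕ)
    (h : ∀ j, IsKFun (m₀ + j) (restr u (m₀ + j))) : Admissible u := by
  have hdown : ∀ k m, IsKFun (m + k) (restr u (m + k)) → IsKFun m (restr u m) := by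
    intro k
    induction k with
    | zero => exact fun m hm => hm
    | succ k ih => exact fun m hm => ih m (isKFun_restr_of_succ hm)
  exact ⟨hu, fun m _ => hdown m₀ m (by rw [add_comm]; exact h m)⟩

lemma tendsto_floor_mul_div (x : ℝ) :
    Filter.Tendsto (fun t : ℝ => (⌊x * t⌋ : ℝ) / t) Filter.atTop (nhds x) := by
  have hlow : Filter.Tendsto (fun t : ℝ => x - t⁻¹) Filter.atTop (nhds x) := by
    simpa using tendsto_const_nhds.sub (tendsto_inv_atTop_zero (𝕜 := ℝ))
  refine tendsto_of_tendsto_of_tendsto_of_le_of_le' hlow tendsto_const_nhds ?_ ?_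
  · filter_upwards [Filter.eventually_gt_atTop 0] with t ht
    rw [le_div_iff₀ ht, sub_mul, inv_mul_cancel₀ ht.ne']
    exact (Int.sub_one_lt_floor _).le
  · filter_upwards [Filter.eventually_gt_atTop 0] with t ht
    rw [div_le_iff₀ ht]
    exact Int.floor_le _

lemma eq_of_restr_eq {u v : AddCircle (1 : ℝ) → ℝ} (hu : Continuous u) (hv : Continuous v)
    (m₀ : ℕ) (h : ∀ j, restr u (m₀ + j) = restr v (m₀ + j)) : u = v := by
  funext t
  induction t using QuotientAddGroup.induction_on with
  | H x =>
  have hNlim : Filter.Tendsto (fun j => ((Nm (m₀ + j) : ℕ) : ℝ)) Filter.atTop Filter.atTop := by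
    refine tendsto_natCast_atTop_atTop.comp
      (Filter.tendsto_atTop_mono (fun j => ?_) Filter.tendsto_id)
    have h1 : m₀ + j < 5 ^ (m₀ + j) := Nat.lt_pow_self (by norm_num)
    simp only [Nm, id]
    omega
  have hx : Filter.Tendsto (fun j => (⌊x * (Nm (m₀ + j) : ℝ)⌋ : ℝ) / (Nm (m₀ + j) : ℝ))
      Filter.atTop (nhds x) := (tendsto_floor_mul_div x).comp hNlim
  have hlim : ∀ w : AddCircle (1 : ℝ) → ℝ, Continuous w →
      Filter.Tendsto (fun j => restr w (m₀ + j)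
        ((⌊x * (Nm (m₀ + j) : ℝ)⌋ : ℤ) : ZMod (Nm (m₀ + j)))) Filter.atTop (nhds (w x)) := by
    intro w hw
    simp only [restr_intCast]
    exact ((hw.comp (AddCircle.continuous_mk' 1)).tendsto x).comp hx
  refine tendsto_nhds_unique (hlim u hu) ((hlim v hv).congr fun j => ?_)
  rw [h]

lemma isEigenK_of_isEigen {u : AddCircle (1 : ℝ) → ℝ} (hu : Admissible u) {m₀ : ℕ} {L : ℕ → ℝ}
    (h : ∀ j, IsEigen (m₀ + j) (L j) (restr u (m₀ + j))) {lam : ℝ}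
    (hlam : Filter.Tendsto (fun j => (15 : ℝ) ^ (m₀ + j) * L j) Filter.atTop (nhds lam)) :
    IsEigenK lam u := by
  refine ⟨hu, ?_, fun ε hε => ?_⟩
  · rintro rfl
    exact (h 0).2.1 rfl
  obtain ⟨B, hB⟩ := isCompact_univ.exists_bound_of_continuousOn hu.1.continuousOn
  have hB0 : 0 ≤ B := (norm_nonneg _).trans (hB 0 (Set.mem_univ _))
  obtain ⟨J, hJ⟩ := Metric.tendsto_atTop.1 hlam (ε / (B + 1)) (by positivity)
  refine ⟨m₀ + J, fun m hm n => ?_⟩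
  obtain ⟨j, rfl⟩ := Nat.exists_eq_add_of_le (le_of_add_le_left hm)
  have h1 := hJ j (by omega)
  rw [Real.dist_eq, lt_div_iff₀ (by positivity)] at h1
  rw [(h j).2.2 n, ← mul_assoc, ← sub_mul, abs_mul]
  refine lt_of_le_of_lt ?_ h1
  gcongr
  exact (hB _ (Set.mem_univ _)).trans (by linarith)

/-- The full conclusion, for named sequences of eigenvalues and eigenfunctions. -/
lemma limit_of_extensions {m₀ : ℕ} (hm₀ : 1 ≤ m₀) {L : ℕ → ℝ}
    {U : ∀ j, ZMod (Nm (m₀ + j)) → ℝ} (h0 : IsEigen m₀ (L 0) (U 0))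
    (hL : ∀ j, L (j + 1) = phi1 (L j))
    (hU : ∀ j, U (j + 1) = extFun (m₀ + j) (L (j + 1)) (U j)) :
    ∃ lam : ℝ, Filter.Tendsto (fun j => (15 : ℝ) ^ (m₀ + j) * L j) Filter.atTop (nhds lam) ∧
      (∃! u : AddCircle (1 : ℝ) → ℝ, Admissible u ∧ ∀ j n, restr u (m₀ + j) n = U j n) ∧
      ∀ u : AddCircle (1 : ℝ) → ℝ, (Admissible u ∧ ∀ j n, restr u (m₀ + j) n = U j n) →
        IsEigenK lam u := by
  obtain ⟨hl0, hl8⟩ := h0.mem_Ico hm₀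
  obtain ⟨lam, hlam⟩ := orbit_tendsto hl0 hl8 hL m₀
  have hE : ∀ j, IsEigen (m₀ + j) (L j) (U j) := by
    intro j
    induction j with
    | zero => exact h0
    | succ j ih =>
      obtain ⟨h1, h2, h3⟩ := orbit_spec hl0 hl8 hL j
      rw [← h3] at ih
      rw [hU]
      exact ih.extFun h2.ne (by linarith)
  refine ⟨lam, hlam, ?_, fun u hu => isEigenK_of_isEigen hu.1 (fun j => ?_) hlam⟩
  · obtain ⟨C, hC⟩ := exists_osc_bound hl0 hl8 hL U hU
    obtain ⟨u, hu, hval⟩ := exists_continuous_of_osc (N := fun j => Nm (m₀ + j))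
      (g := fun j z => U j (z : ZMod (Nm (m₀ + j)))) (C := C) (fun j => Nm_pos _)
      (fun j => Nm_succ _) (fun j z => by simp)
      (fun j z => by
        simp only [hU]
        exact extFun_five_mul z)
      (fun j z => by
        push_cast
        exact hC j z)
    have hres : ∀ j n, restr u (m₀ + j) n = U j n := by
      intro j n
      obtain ⟨z, rfl⟩ := ZMod.intCast_surjective n
      rw [restr_intCast]
      exact hval j z
    have hres' : ∀ j, restr u (m₀ + j) = U j := fun j => funext (hres j)
    refine ⟨u, ⟨admissible_of_isKFun hu m₀ fun j => ?_, hres⟩, ?_⟩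
    · rw [hres']
      exact (hE j).1
    · rintro v ⟨hv, hvres⟩
      exact eq_of_restr_eq hv.1 hu m₀ fun j => by rw [hres' j]; exact funext (hvres j)
  · rw [show restr u (m₀ + j) = U j from funext (hu.2 j)]
    exact hE j

/-- Starting from a `λ_{m₀}`-eigenfunction of `−Δ_{m₀}` and repeatedly
taking `φ₁`-extensions, there is a unique admissible continuous function on the circle
restricting to all the resulting eigenfunctions, and it is a `λ`-eigenfunction of `−Δ`
on `K` with `λ = lim_m 15^m λ_m`. -/
theorem extension_limit_is_eigenfunction (m₀ : ℕ) (hm₀ : 1 ≤ m₀) (lam0 : ℝ)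
    (u0 : ZMod (Nm m₀) → ℝ) (h0 : IsEigen m₀ lam0 u0) :
    ∃ lam : ℝ,
      Filter.Tendsto (fun j => (15 : ℝ) ^ (m₀ + j) *
          (Nat.rec (motive := fun _ => ℝ) lam0 (fun _ x => phi1 x) j))
        Filter.atTop (nhds lam) ∧
      (∃! u : AddCircle (1 : ℝ) → ℝ, Admissible u ∧
        ∀ j : ℕ, ∀ n : ZMod (Nm (m₀ + j)), restr u (m₀ + j) n =
          (Nat.rec (motive := fun j => ZMod (Nm (m₀ + j)) → ℝ) u0
            (fun j v => extFun (m₀ + j)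
              (Nat.rec (motive := fun _ => ℝ) lam0 (fun _ x => phi1 x) (j + 1)) v) j) n) ∧
      (∀ u : AddCircle (1 : ℝ) → ℝ, (Admissible u ∧
        ∀ j : ℕ, ∀ n : ZMod (Nm (m₀ + j)), restr u (m₀ + j) n =
          (Nat.rec (motive := fun j => ZMod (Nm (m₀ + j)) → ℝ) u0
            (fun j v => extFun (m₀ + j)
              (Nat.rec (motive := fun _ => ℝ) lam0 (fun _ x => phi1 x) (j + 1)) v) j) n) →
        IsEigenK lam u) := by
  exact limit_of_extensions hm₀ (L := fun j => Nat.rec (motive := fun _ => ℝ) lam0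
    (fun _ x => phi1 x) j) h0 (fun _ => rfl) (fun _ => rfl)

end VNLE
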